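/- Let X = ℝⁿ, n ≥ 2, with κ the α-Riesz kernel of order α ∈ (0, n). Let f be an external field, and let A ⊆ ℝⁿ be such that E⁺(A) is closed in the strong metric d (in particular, A quasiclosed suffices), w_f(A) < ∞, and cap_*(A) < ∞. Then the inner Gauss variational problem for (A, f) has a unique solution λ_{A,f}. -/

import Mathlib

open MeasureTheory Topology Filter Set ENNReal

noncomputable section

namespace GaussVar

variable {X : Type*} [TopologicalSpace X] [MeasurableSpace X]

/-- A (positive) Radon measure: a regular Borel measure. -/
def IsRadon (μ : Measure X) : Prop := μ.Regular

/-- The mutual energy `I(μ,ν) = ∬ κ(x,y) d(μ⊗ν)(x,y)`. -/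
def mutualEnergy (κ : X → X → ℝ≥0∞) (μ ν : Measure X) : ℝ≥0∞ :=
  ∫⁻ p : X × X, κ p.1 p.2 ∂(μ.prod ν)

/-- The energy `I(μ) := I(μ,μ)`. -/
def energy (κ : X → X → ℝ≥0∞) (μ : Measure X) : ℝ≥0∞ := mutualEnergy κ μ μ

/-- Membership in the cone `E⁺` of Radon measures with finite energy. -/
def memEplus (κ : X → X → ℝ≥0∞) (μ : Measure X) : Prop :=
  IsRadon μ ∧ energy κ μ < ⊤

/-- A kernel: symmetric and lower semicontinuous with values in `[0,∞]`. -/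
def IsKernel (κ : X → X → ℝ≥0∞) : Prop :=
  (∀ x y, κ x y = κ y x) ∧ LowerSemicontinuous (fun p : X × X => κ p.1 p.2)

/-- The strong (energy) metric `d(μ,ν) := (I(μ)+I(ν)−2I(μ,ν))^{1/2}` on `E⁺`. -/
def strongDist (κ : X → X → ℝ≥0∞) (μ ν : Measure X) : ℝ :=
  Real.sqrt ((energy κ μ).toReal + (energy κ ν).toReal - 2 * (mutualEnergy κ μ ν).toReal)

/-- The energy principle (strict positive definiteness). -/
def EnergyPrinciple (κ : X → X → ℝ≥0∞) : Prop :=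
  ∀ μ ν : Measure X, memEplus κ μ → memEplus κ ν →
    2 * mutualEnergy κ μ ν ≤ energy κ μ + energy κ ν ∧
      (2 * mutualEnergy κ μ ν = energy κ μ + energy κ ν → μ = ν)

/-- Convergence of a sequence in the strong metric. -/
def StrongTendstoSeq (κ : X → X → ℝ≥0∞) (μ : ℕ → Measure X) (μ₀ : Measure X) : Prop :=
  Tendsto (fun n => strongDist κ (μ n) μ₀) atTop (𝓝 0)

/-- Vague convergence of a sequence of measures. -/
def VagueTendstoSeq (μ : ℕ → Measure X) (μ₀ : Measure X) : Prop :=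
  ∀ φ : X → ℝ, Continuous φ → HasCompactSupport φ →
    Tendsto (fun n => ∫ x, φ x ∂(μ n)) atTop (𝓝 (∫ x, φ x ∂μ₀))

/-- Cauchy sequence in the strong metric. -/
def StrongCauchySeq (κ : X → X → ℝ≥0∞) (μ : ℕ → Measure X) : Prop :=
  ∀ ε : ℝ, 0 < ε → ∃ N : ℕ, ∀ m ≥ N, ∀ n ≥ N, strongDist κ (μ m) (μ n) < ε

/-- A perfect kernel: satisfies the energy principle, `(E⁺,d)` is complete, and
strong convergence implies vague convergence. -/
def IsPerfect (κ : X → X → ℝ≥0∞) : Prop :=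
  EnergyPrinciple κ ∧
    (∀ μ : ℕ → Measure X, (∀ n, memEplus κ (μ n)) → StrongCauchySeq κ μ →
        ∃ μ₀ : Measure X, memEplus κ μ₀ ∧ StrongTendstoSeq κ μ μ₀) ∧
    (∀ (μ : ℕ → Measure X) (μ₀ : Measure X), (∀ n, memEplus κ (μ n)) → memEplus κ μ₀ →
        StrongTendstoSeq κ μ μ₀ → VagueTendstoSeq μ μ₀)

/-- `μ` is concentrated on `A`: the complement of `A` is locally `μ`-negligible. -/
def Concentrated (μ : Measure X) (A : Set X) : Prop :=
  ∀ K : Set X, IsCompact K → μ (Aᶜ ∩ K) = 0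

/-- Membership in `Ĕ⁺(A)`: finite-energy Radon measures concentrated on `A`
of unit total mass. -/
def memBreve (κ : X → X → ℝ≥0∞) (A : Set X) (μ : Measure X) : Prop :=
  memEplus κ μ ∧ Concentrated μ A ∧ μ Set.univ = 1

/-- `w(A) := inf { I(μ) : μ ∈ Ĕ⁺(A) }` (with `inf ∅ = ⊤`). -/
def wcap (κ : X → X → ℝ≥0∞) (A : Set X) : ℝ≥0∞ :=
  ⨅ (μ : Measure X) (_ : memBreve κ A μ), energy κ μ

/-- The inner capacity `cap_*(A) := 1 / w(A)`. -/
def innerCap (κ : X → X → ℝ≥0∞) (A : Set X) : ℝ≥0∞ := (wcap κ A)⁻¹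

/-- The outer capacity `cap^*(E) := inf { cap_*(D) : D open, E ⊆ D }`. -/
def outerCap (κ : X → X → ℝ≥0∞) (E : Set X) : ℝ≥0∞ :=
  ⨅ (D : Set X) (_ : IsOpen D ∧ E ⊆ D), innerCap κ D

/-- `P` holds nearly everywhere (n.e.) on `A`: the exceptional subset of `A`
has inner capacity zero. -/
def NearlyEverywhere (κ : X → X → ℝ≥0∞) (A : Set X) (P : X → Prop) : Prop :=
  innerCap κ {x ∈ A | ¬ P x} = 0

/-- The potential `U^μ(x) := ∫ κ(x,y) dμ(y)`. -/
def potential (κ : X → X → ℝ≥0∞) (μ : Measure X) (x : X) : ℝ≥0∞ :=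
  ∫⁻ y, κ x y ∂μ

/-- An external field: `f = ψ + U^{ϑ⁺} − U^{ϑ⁻}` where `ψ` is lower semicontinuous,
`(−∞,∞]`-valued, positive if `X` is noncompact, and `ϑ⁺, ϑ⁻ ∈ E⁺`. -/
def IsExternalField (κ : X → X → ℝ≥0∞) (f : X → EReal) : Prop :=
  ∃ (ψ : X → EReal) (ϑp ϑm : Measure X),
    LowerSemicontinuous ψ ∧ (∀ x, ψ x ≠ ⊥) ∧ (¬ CompactSpace X → ∀ x, 0 ≤ ψ x) ∧
    memEplus κ ϑp ∧ memEplus κ ϑm ∧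
    ∀ x, f x = ψ x + (potential κ ϑp x : EReal) - (potential κ ϑm x : EReal)

/-- `f` is `μ`-integrable (as an extended-real-valued function). -/
def FieldIntegrable (f : X → EReal) (μ : Measure X) : Prop :=
  Integrable (fun x => (f x).toReal) μ ∧ (∀ᵐ x ∂μ, f x ≠ ⊤ ∧ f x ≠ ⊥)

/-- `∫ f dμ` for an a.e.-finite integrable field. -/
def fieldIntegral (f : X → EReal) (μ : Measure X) : ℝ := ∫ x, (f x).toReal ∂μ

/-- The Gauss functional `I_f(μ) := I(μ) + 2 ∫ f dμ`. -/
def gaussI (κ : X → X → ℝ≥0∞) (f : X → EReal) (μ : Measure X) : ℝ :=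
  (energy κ μ).toReal + 2 * fieldIntegral f μ

/-- Membership in `Ĕ⁺_f(A)`. -/
def Admissible (κ : X → X → ℝ≥0∞) (A : Set X) (f : X → EReal) (μ : Measure X) : Prop :=
  memBreve κ A μ ∧ FieldIntegrable f μ

/-- `w_f(A) := inf { I_f(μ) : μ ∈ Ĕ⁺_f(A) }` (with `inf ∅ = ⊤`). -/
def wf (κ : X → X → ℝ≥0∞) (A : Set X) (f : X → EReal) : EReal :=
  ⨅ (μ : Measure X) (_ : Admissible κ A f μ), ((gaussI κ f μ : ℝ) : EReal)

/-- `l` is a solution of the inner Gauss variational problem for `(A,f)`. -/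
def IsSolution (κ : X → X → ℝ≥0∞) (A : Set X) (f : X → EReal) (l : Measure X) : Prop :=
  Admissible κ A f l ∧ ((gaussI κ f l : ℝ) : EReal) = wf κ A f

/-- The `f`-weighted potential `U_f^μ := U^μ + f`. -/
def wPotential (κ : X → X → ℝ≥0∞) (f : X → EReal) (μ : Measure X) (x : X) : EReal :=
  (potential κ μ x : EReal) + f x

/-- `∫ U_f^μ dμ`, the weighted equilibrium constant of a solution. -/
def wConst (κ : X → X → ℝ≥0∞) (f : X → EReal) (μ : Measure X) : ℝ :=
  ∫ x, (wPotential κ f μ x).toReal ∂μ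

/-- The cone `E⁺(A)` is closed in the strong metric. -/
def StrongClosedEplusOn (κ : X → X → ℝ≥0∞) (A : Set X) : Prop :=
  ∀ (μ : ℕ → Measure X) (μ₀ : Measure X),
    (∀ n, memEplus κ (μ n) ∧ Concentrated (μ n) A) →
    memEplus κ μ₀ → StrongTendstoSeq κ μ μ₀ → Concentrated μ₀ A

/-- Frostman's (first) maximum principle. -/
def FrostmanMax (κ : X → X → ℝ≥0∞) : Prop :=
  ∀ μ : Measure X, memEplus κ μ →
    (∀ x : X, (∀ U : Set X, IsOpen U → x ∈ U → 0 < μ U) → potential κ μ x ≤ 1) →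
    ∀ x : X, potential κ μ x ≤ 1

/-- The domination (second maximum) principle. -/
def DominationPrinciple (κ : X → X → ℝ≥0∞) : Prop :=
  ∀ μ ν : Measure X, memEplus κ μ → memEplus κ ν →
    (∀ᵐ x ∂μ, potential κ μ x ≤ potential κ ν x) →
    ∀ x : X, potential κ μ x ≤ potential κ ν x

/-- `β` is the inner balayage of `ζ` onto `A`: `β ∈ E⁺(A)` and `U^β = U^ζ` n.e. on `A`. -/
def IsInnerBalayage (κ : X → X → ℝ≥0∞) (A : Set X) (ζ β : Measure X) : Prop :=
  memEplus κ β ∧ Concentrated β A ∧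
    NearlyEverywhere κ A (fun x => potential κ β x = potential κ ζ x)

/-- `γ` is the inner capacitary measure of `A`: `γ ∈ E⁺(A)` and `U^γ = 1` n.e. on `A`. -/
def IsCapacitaryMeasure (κ : X → X → ℝ≥0∞) (A : Set X) (γ : Measure X) : Prop :=
  memEplus κ γ ∧ Concentrated γ A ∧
    NearlyEverywhere κ A (fun x => potential κ γ x = 1)

/-- `A` is quasiclosed: approximable in outer capacity by closed sets. -/
def Quasiclosed (κ : X → X → ℝ≥0∞) (A : Set X) : Prop :=
  ∀ ε : ℝ≥0∞, 0 < ε → ∃ F : Set X, IsClosed F ∧ outerCap κ (symmDiff A F) < ε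

/-- `A` is quasicompact: approximable in outer capacity by compact sets. -/
def Quasicompact (κ : X → X → ℝ≥0∞) (A : Set X) : Prop :=
  ∀ ε : ℝ≥0∞, 0 < ε → ∃ K : Set X, IsCompact K ∧ outerCap κ (symmDiff A K) < ε


/-- Euclidean space `ℝⁿ`. -/
abbrev Rn (n : ℕ) := EuclideanSpace ℝ (Fin n)

/-- The α-Riesz kernel `|x−y|^(α−n)` on `ℝⁿ` (with value `∞` on the diagonal). -/
def rieszKernel (n : ℕ) (α : ℝ) : Rn n → Rn n → ℝ≥0∞ :=
  fun x y => (ENNReal.ofReal (dist x y)) ^ (α - (n : ℝ))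

/-- `B` is inner α-thin at infinity. -/
def InnerThinAtInfinity (n : ℕ) (α : ℝ) (B : Set (Rn n)) : Prop :=
  ∃ q : ℝ, 1 < q ∧
    (∑' k : ℕ, innerCap (rieszKernel n α)
        (B ∩ {x : Rn n | q ^ k ≤ ‖x‖ ∧ ‖x‖ < q ^ (k + 1)}) /
      ENNReal.ofReal (q ^ ((k : ℝ) * ((n : ℝ) - α)))) ≠ ⊤

/-- The Gaussian feature `exp (-2 t |x - z|²)` of the point `x` at scale `t` and centre `z`. -/
def gaussFeature {n : ℕ} (w : ℝ × Rn n) (x : Rn n) : ℝ :=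
  Real.exp (-(2 * w.1) * ‖x - w.2‖ ^ 2)

/-- The density of scales that turns Gaussians into the Riesz kernel. -/
def scaleDensity (n : ℕ) (α t : ℝ) : ℝ :=
  t ^ (((n : ℝ) - α) / 2 - 1) * ((Real.pi / (4 * t)) ^ ((n : ℝ) / 2))⁻¹ /
    Real.Gamma (((n : ℝ) - α) / 2)

/-- The measure on scales and centres representing the Riesz kernel through Gaussian features. -/
def featureMeasure (n : ℕ) (α : ℝ) : Measure (ℝ × Rn n) :=
  ((volume.restrict (Ioi (0 : ℝ))).withDensity
    (fun t => ENNReal.ofReal (scaleDensity n α t))).prod volume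

lemma gaussFeature_pos {n : ℕ} (w : ℝ × Rn n) (x : Rn n) : 0 < gaussFeature w x :=
  Real.exp_pos _

lemma continuous_gaussFeature {n : ℕ} :
    Continuous (fun p : (ℝ × Rn n) × Rn n => gaussFeature p.1 p.2) := by
  unfold gaussFeature; fun_prop

lemma measurable_scaleDensity (n : ℕ) (α : ℝ) : Measurable (scaleDensity n α) := by
  unfold scaleDensity; fun_prop

instance (n : ℕ) (α : ℝ) : SigmaFinite (featureMeasure n α) := by
  unfold featureMeasure
  have : SigmaFinite ((volume.restrict (Ioi (0 : ℝ))).withDensity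
    (fun t => ENNReal.ofReal (scaleDensity n α t))) :=
    SigmaFinite.withDensity_ofReal _
  infer_instance

lemma integrable_exp_neg_mul_norm_sq {n : ℕ} {b : ℝ} (hb : 0 < b) (c : Rn n) :
    Integrable (fun z : Rn n => Real.exp (-b * ‖z - c‖ ^ 2)) := by
  have h := (GaussianFourier.integrable_cexp_neg_mul_sq_norm_add (V := Rn n)
    (b := (b : ℂ)) (by simpa using hb) 0 0).norm
  have h' : Integrable (fun z : Rn n => Real.exp (-b * ‖z‖ ^ 2)) := by
    refine h.congr (ae_of_all _ fun z => ?_)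
    simp only [Complex.norm_exp]
    congr 1
    rw [← Complex.ofReal_pow, ← Complex.ofReal_neg, ← Complex.ofReal_mul]
    simp [-Complex.ofReal_pow]
  exact h'.comp_sub_right c

lemma lintegral_gaussFeature_mul {n : ℕ} {t : ℝ} (ht : 0 < t) (x y : Rn n) :
    ∫⁻ z, ENNReal.ofReal (gaussFeature (t, z) x) * ENNReal.ofReal (gaussFeature (t, z) y) =
      ENNReal.ofReal ((Real.pi / (4 * t)) ^ ((n : ℝ) / 2) * Real.exp (-t * ‖x - y‖ ^ 2)) := by
  have key : ∀ z : Rn n, gaussFeature (t, z) x * gaussFeature (t, z) y =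
      Real.exp (-(4 * t) * ‖z - (2⁻¹ : ℝ) • (x + y)‖ ^ 2) * Real.exp (-t * ‖x - y‖ ^ 2) := by
    intro z
    simp only [gaussFeature]
    rw [← Real.exp_add, ← Real.exp_add]
    congr 1
    have h := parallelogram_law_with_norm ℝ (x - z) (y - z)
    have h1 : x - z + (y - z) = -(2 : ℝ) • (z - (2⁻¹ : ℝ) • (x + y)) := by
      simp only [smul_sub, smul_smul, neg_smul]; norm_num; module
    have h2 : x - z - (y - z) = x - y := by abel
    rw [h1, h2, norm_smul] at h
    rw [show ‖(-2 : ℝ)‖ = 2 by norm_num] at h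
    linear_combination t * h
  have h_int := integrable_exp_neg_mul_norm_sq (n := n) (b := 4 * t) (by positivity)
    ((2⁻¹ : ℝ) • (x + y))
  calc _ = ∫⁻ z, ENNReal.ofReal (Real.exp (-(4 * t) * ‖z - (2⁻¹ : ℝ) • (x + y)‖ ^ 2) *
        Real.exp (-t * ‖x - y‖ ^ 2)) := by
        refine lintegral_congr fun z => ?_
        rw [← ENNReal.ofReal_mul (gaussFeature_pos _ _).le, key]
    _ = _ := by
        rw [← ofReal_integral_eq_lintegral_ofReal (h_int.mul_const _)
          (ae_of_all _ fun z => by positivity), integral_mul_const,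
          integral_sub_right_eq_self (fun z : Rn n => Real.exp (-(4 * t) * ‖z‖ ^ 2)),
          GaussianFourier.integral_rexp_neg_mul_sq_norm (by positivity)]
        simp

lemma lintegral_rpow_mul_exp_neg_mul {s r : ℝ} (hs : 0 < s) (hr : 0 ≤ r) :
    ∫⁻ t in Ioi (0 : ℝ), ENNReal.ofReal (t ^ (s - 1) / Real.Gamma s * Real.exp (-t * r ^ 2)) =
      ENNReal.ofReal r ^ (-(2 * s)) := by
  have hG := Real.Gamma_pos_of_pos hs
  have hnn : ∀ᵐ t ∂(volume.restrict (Ioi (0 : ℝ))),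
      0 ≤ t ^ (s - 1) / Real.Gamma s * Real.exp (-t * r ^ 2) := by
    filter_upwards [ae_restrict_mem measurableSet_Ioi] with t ht
    have : (0 : ℝ) < t := ht
    positivity
  rcases hr.eq_or_lt with rfl | hr
  · rw [ENNReal.ofReal_zero, ENNReal.zero_rpow_of_neg (by linarith)]
    by_contra hne
    have h_int : IntegrableOn (fun t : ℝ => t ^ (s - 1) / Real.Gamma s *
        Real.exp (-t * 0 ^ 2)) (Ioi 0) :=
      (lintegral_ofReal_ne_top_iff_integrable (by fun_prop) hnn).1 hne
    refine not_integrableOn_Ioi_rpow (s - 1) ?_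
    refine (h_int.const_mul (Real.Gamma s)).congr (ae_of_all _ fun t => ?_)
    simp
    field_simp
  · have hI : ∫ t in Ioi (0 : ℝ), t ^ (s - 1) * Real.exp (-(r ^ 2 * t)) =
        (1 / r ^ 2) ^ s * Real.Gamma s :=
      Real.integral_rpow_mul_exp_neg_mul_Ioi hs (by positivity)
    have hI' : ∫ t in Ioi (0 : ℝ), t ^ (s - 1) / Real.Gamma s * Real.exp (-t * r ^ 2) =
        r ^ (-(2 * s)) := by
      have : ∀ t : ℝ, t ^ (s - 1) / Real.Gamma s * Real.exp (-t * r ^ 2) =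
          (Real.Gamma s)⁻¹ * (t ^ (s - 1) * Real.exp (-(r ^ 2 * t))) := by
        intro t
        rw [show -t * r ^ 2 = -(r ^ 2 * t) by ring]; ring
      simp_rw [this]
      rw [integral_const_mul, hI, mul_comm, mul_assoc, mul_inv_cancel₀ hG.ne', mul_one, one_div,
        ← Real.rpow_natCast, ← Real.rpow_neg hr.le, ← Real.rpow_mul hr.le]
      congr 1; push_cast; ring
    rw [← ofReal_integral_eq_lintegral_ofReal ?_ hnn, hI', ENNReal.ofReal_rpow_of_pos hr]
    by_contra hne
    rw [integral_undef hne] at hI'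
    exact (Real.rpow_pos_of_pos hr _).ne hI'

lemma lintegral_gaussFeature_mul_featureMeasure {n : ℕ} {α : ℝ} (hαn : α < n) (x y : Rn n) :
    ∫⁻ w, ENNReal.ofReal (gaussFeature w x) * ENNReal.ofReal (gaussFeature w y)
      ∂(featureMeasure n α) = rieszKernel n α x y := by
  have hc : ∀ x : Rn n, Measurable (fun w : ℝ × Rn n => ENNReal.ofReal (gaussFeature w x)) :=
    fun x => (continuous_gaussFeature.comp (by fun_prop : Continuous fun w : ℝ × Rn n => (w, x))
      ).measurable.ennreal_ofReal
  have hm : Measurable (fun w : ℝ × Rn n =>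
      ENNReal.ofReal (gaussFeature w x) * ENNReal.ofReal (gaussFeature w y)) := (hc x).mul (hc y)
  have hs : 0 < ((n : ℝ) - α) / 2 := by linarith
  have hG := Real.Gamma_pos_of_pos hs
  have hd := (measurable_scaleDensity n α).ennreal_ofReal
  rw [featureMeasure, lintegral_prod _ hm.aemeasurable,
    lintegral_withDensity_eq_lintegral_mul _ hd (Measurable.lintegral_prod_right' hm)]
  have h2 : rieszKernel n α x y =
      ENNReal.ofReal (dist x y) ^ (-(2 * (((n : ℝ) - α) / 2))) := by
    rw [rieszKernel]; congr 1; ring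
  rw [h2, ← lintegral_rpow_mul_exp_neg_mul hs dist_nonneg]
  refine setLIntegral_congr_fun measurableSet_Ioi fun t ht => ?_
  have ht : 0 < t := ht
  simp only [Pi.mul_apply]
  rw [lintegral_gaussFeature_mul ht, ← ENNReal.ofReal_mul (by unfold scaleDensity; positivity),
    scaleDensity, dist_eq_norm]
  congr 1
  have : (Real.pi / (4 * t)) ^ ((n : ℝ) / 2) ≠ 0 := by positivity
  field_simp

/-- The Gaussian transform `w ↦ ∫ exp (-2 t |x - z|²) dμ(x)` of a measure, for `w = (t, z)`. -/
def gaussTransform {n : ℕ} (μ : Measure (Rn n)) (w : ℝ × Rn n) : ℝ≥0∞ :=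
  ∫⁻ x, ENNReal.ofReal (gaussFeature w x) ∂μ

section

variable {n : ℕ} {α : ℝ} {μ ν : Measure (Rn n)}

lemma memEplus.sigmaFinite (h : memEplus (rieszKernel n α) μ) : SigmaFinite μ := by
  have : μ.Regular := h.1
  infer_instance

lemma measurable_gaussFeature {n : ℕ} :
    Measurable (fun p : (ℝ × Rn n) × Rn n => ENNReal.ofReal (gaussFeature p.1 p.2)) :=
  continuous_gaussFeature.measurable.ennreal_ofReal

lemma measurable_gaussTransform [SFinite μ] : Measurable (gaussTransform μ) :=
  Measurable.lintegral_prod_right' measurable_gaussFeature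

lemma mutualEnergy_eq_lintegral (hαn : α < n) [SFinite μ] [SFinite ν] :
    mutualEnergy (rieszKernel n α) μ ν =
      ∫⁻ w, gaussTransform μ w * gaussTransform ν w ∂(featureMeasure n α) := by
  have hm : Measurable (fun p : (Rn n × Rn n) × (ℝ × Rn n) =>
      ENNReal.ofReal (gaussFeature p.2 p.1.1) * ENNReal.ofReal (gaussFeature p.2 p.1.2)) :=
    (measurable_gaussFeature.comp (by fun_prop :
      Measurable fun p : (Rn n × Rn n) × (ℝ × Rn n) => (p.2, p.1.1))).mul
    (measurable_gaussFeature.comp (by fun_prop :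
      Measurable fun p : (Rn n × Rn n) × (ℝ × Rn n) => (p.2, p.1.2)))
  unfold mutualEnergy
  simp_rw [← lintegral_gaussFeature_mul_featureMeasure hαn]
  rw [lintegral_lintegral_swap hm.aemeasurable]
  refine lintegral_congr fun w => ?_
  have hw : Measurable (fun x => ENNReal.ofReal (gaussFeature w x)) :=
    measurable_gaussFeature.comp (by fun_prop : Measurable fun x : Rn n => (w, x))
  exact lintegral_prod_mul hw.aemeasurable hw.aemeasurable

lemma energy_eq_lintegral (hαn : α < n) [SFinite μ] :
    energy (rieszKernel n α) μ = ∫⁻ w, gaussTransform μ w ^ 2 ∂(featureMeasure n α) := by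
  simp_rw [energy, mutualEnergy_eq_lintegral hαn, sq]

lemma memEplus.gaussTransform_lt_top (hαn : α < n) (h : memEplus (rieszKernel n α) μ) :
    ∀ᵐ w ∂(featureMeasure n α), gaussTransform μ w < ⊤ := by
  have := h.sigmaFinite
  have h1 := h.2
  rw [energy_eq_lintegral hαn] at h1
  filter_upwards [ae_lt_top (measurable_gaussTransform.pow_const 2) h1.ne] with w hw
  contrapose! hw
  simp [top_le_iff.1 hw]

lemma memEplus.memLp_gaussTransform (hαn : α < n) (h : memEplus (rieszKernel n α) μ) :
    MemLp (fun w => (gaussTransform μ w).toReal) 2 (featureMeasure n α) := by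
  have := h.sigmaFinite
  have h1 := h.2
  rw [energy_eq_lintegral hαn] at h1
  have hm : Measurable (gaussTransform μ) := measurable_gaussTransform
  rw [memLp_two_iff_integrable_sq hm.ennreal_toReal.aestronglyMeasurable]
  have := integrable_toReal_of_lintegral_ne_top (hm.pow_const 2).aemeasurable h1.ne
  simpa using this

lemma energy_lt_top_of_memLp (hαn : α < n) [SFinite μ]
    (hfin : ∀ᵐ w ∂(featureMeasure n α), gaussTransform μ w < ⊤)
    (h : MemLp (fun w => (gaussTransform μ w).toReal) 2 (featureMeasure n α)) :
    energy (rieszKernel n α) μ < ⊤ := by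
  rw [energy_eq_lintegral hαn]
  convert h.integrable_sq.lintegral_lt_top using 1
  refine lintegral_congr_ae ?_
  filter_upwards [hfin] with w hw
  rw [ENNReal.ofReal_pow ENNReal.toReal_nonneg, ENNReal.ofReal_toReal hw.ne]

open Classical in
variable (n α μ) in
/-- The vector of `L²` representing a measure of finite Riesz energy. -/
def energyVec : Lp ℝ 2 (featureMeasure n α) :=
  if h : MemLp (fun w => (gaussTransform μ w).toReal) 2 (featureMeasure n α) then h.toLp _ else 0

lemma memEplus.coeFn_energyVec (hαn : α < n) (h : memEplus (rieszKernel n α) μ) :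
    energyVec n α μ =ᵐ[featureMeasure n α] fun w => (gaussTransform μ w).toReal := by
  rw [energyVec, dif_pos (h.memLp_gaussTransform hαn)]
  exact MemLp.coeFn_toLp _

lemma inner_energyVec (hαn : α < n) (hμ : memEplus (rieszKernel n α) μ)
    (hν : memEplus (rieszKernel n α) ν) :
    inner ℝ (energyVec n α μ) (energyVec n α ν) =
      (mutualEnergy (rieszKernel n α) μ ν).toReal := by
  have := hμ.sigmaFinite
  have := hν.sigmaFinite
  rw [mutualEnergy_eq_lintegral hαn, L2.inner_def, ← integral_toReal]
  · refine integral_congr_ae ?_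
    filter_upwards [hμ.coeFn_energyVec hαn, hν.coeFn_energyVec hαn] with w h1 h2
    rw [h1, h2]
    simp [mul_comm]
  · exact (measurable_gaussTransform.mul measurable_gaussTransform).aemeasurable
  · filter_upwards [hμ.gaussTransform_lt_top hαn, hν.gaussTransform_lt_top hαn] with w h1 h2
    exact ENNReal.mul_lt_top h1 h2

lemma norm_energyVec_sq (hαn : α < n) (hμ : memEplus (rieszKernel n α) μ) :
    ‖energyVec n α μ‖ ^ 2 = (energy (rieszKernel n α) μ).toReal := by
  rw [← real_inner_self_eq_norm_sq, inner_energyVec hαn hμ hμ, energy]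

lemma mutualEnergy_lt_top (hαn : α < n) (hμ : memEplus (rieszKernel n α) μ)
    (hν : memEplus (rieszKernel n α) ν) : mutualEnergy (rieszKernel n α) μ ν < ⊤ := by
  have := hμ.sigmaFinite
  have := hν.sigmaFinite
  have h1 := hμ.2
  have h2 := hν.2
  rw [energy_eq_lintegral hαn] at h1 h2
  rw [mutualEnergy_eq_lintegral hαn]
  refine lt_of_le_of_lt (lintegral_mono fun w => ?_) ((lintegral_add_left
    (measurable_gaussTransform.pow_const 2) _).trans_lt (ENNReal.add_lt_top.2 ⟨h1, h2⟩))
  rcases le_total (gaussTransform μ w) (gaussTransform ν w) with h | h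
  · calc _ ≤ gaussTransform ν w * gaussTransform ν w := by gcongr
      _ ≤ _ := by rw [← sq]; exact le_add_self
  · calc _ ≤ gaussTransform μ w * gaussTransform μ w := by gcongr
      _ ≤ _ := by rw [← sq]; exact le_self_add

lemma strongDist_eq_norm (hαn : α < n) (hμ : memEplus (rieszKernel n α) μ)
    (hν : memEplus (rieszKernel n α) ν) :
    strongDist (rieszKernel n α) μ ν = ‖energyVec n α μ - energyVec n α ν‖ := by
  rw [strongDist, ← norm_energyVec_sq hαn hμ, ← norm_energyVec_sq hαn hν,
    ← inner_energyVec hαn hμ hν, ← Real.sqrt_sq (norm_nonneg (_ - _)), norm_sub_sq_real]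
  congr 1; ring

variable (μ ν) in
/-- The midpoint of two measures. -/
def midMeasure : Measure (Rn n) := (2⁻¹ : ℝ≥0∞) • μ + (2⁻¹ : ℝ≥0∞) • ν

lemma gaussTransform_midMeasure (w : ℝ × Rn n) :
    gaussTransform (midMeasure μ ν) w = 2⁻¹ * gaussTransform μ w + 2⁻¹ * gaussTransform ν w := by
  simp [gaussTransform, midMeasure, lintegral_add_measure, lintegral_smul_measure]

lemma memEplus_midMeasure (hαn : α < n) (hμ : memEplus (rieszKernel n α) μ)
    (hν : memEplus (rieszKernel n α) ν) : memEplus (rieszKernel n α) (midMeasure μ ν) := by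
  have := hμ.sigmaFinite
  have := hν.sigmaFinite
  have : μ.Regular := hμ.1
  have : ν.Regular := hν.1
  have h1 := hμ.2
  have h2 := hν.2
  have : IsFiniteMeasureOnCompacts (midMeasure μ ν) := by
    refine ⟨fun K hK => ?_⟩
    simp only [midMeasure, Measure.coe_add, Measure.coe_smul, Pi.add_apply, Pi.smul_apply,
      smul_eq_mul]
    exact ENNReal.add_lt_top.2 ⟨ENNReal.mul_lt_top (by simp) hK.measure_lt_top,
      ENNReal.mul_lt_top (by simp) hK.measure_lt_top⟩
  refine ⟨show (midMeasure μ ν).Regular from inferInstance, ?_⟩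
  rw [energy_eq_lintegral hαn] at h1 h2 ⊢
  refine lt_of_le_of_lt (lintegral_mono fun w => ?_) ((lintegral_add_left
    (measurable_gaussTransform (μ := μ).pow_const 2)
      (fun w => gaussTransform ν w ^ 2)).trans_lt (ENNReal.add_lt_top.2 ⟨h1, h2⟩))
  rw [gaussTransform_midMeasure]
  have key : ∀ a : ℝ≥0∞, 2⁻¹ * a + 2⁻¹ * a = a := fun a => by
    rw [← add_mul, ENNReal.inv_two_add_inv_two, one_mul]
  rcases le_total (gaussTransform μ w) (gaussTransform ν w) with h | h
  · calc _ ≤ (2⁻¹ * gaussTransform ν w + 2⁻¹ * gaussTransform ν w) ^ 2 := by gcongr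
      _ ≤ _ := by rw [key]; exact le_add_self
  · calc _ ≤ (2⁻¹ * gaussTransform μ w + 2⁻¹ * gaussTransform μ w) ^ 2 := by gcongr
      _ ≤ _ := by rw [key]; exact le_self_add

lemma energyVec_midMeasure (hαn : α < n) (hμ : memEplus (rieszKernel n α) μ)
    (hν : memEplus (rieszKernel n α) ν) :
    energyVec n α (midMeasure μ ν) = (2⁻¹ : ℝ) • (energyVec n α μ + energyVec n α ν) := by
  apply Lp.ext
  filter_upwards [(memEplus_midMeasure hαn hμ hν).coeFn_energyVec hαn, hμ.coeFn_energyVec hαn,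
    hν.coeFn_energyVec hαn, hμ.gaussTransform_lt_top hαn, hν.gaussTransform_lt_top hαn,
    Lp.coeFn_smul (2⁻¹ : ℝ) (energyVec n α μ + energyVec n α ν),
    Lp.coeFn_add (energyVec n α μ) (energyVec n α ν)] with w h1 h2 h3 h4 h5 h6 h7
  rw [h1, h6, Pi.smul_apply, h7, Pi.add_apply, h2, h3, gaussTransform_midMeasure,
    ENNReal.toReal_add (ENNReal.mul_lt_top (by simp) h4).ne (ENNReal.mul_lt_top (by simp) h5).ne]
  simp [mul_add]

/-- The parallelogram identity for energies. -/
lemma norm_energyVec_sub_sq (hαn : α < n) (hμ : memEplus (rieszKernel n α) μ)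
    (hν : memEplus (rieszKernel n α) ν) :
    ‖energyVec n α μ - energyVec n α ν‖ ^ 2 = 2 * (energy (rieszKernel n α) μ).toReal +
      2 * (energy (rieszKernel n α) ν).toReal -
        4 * (energy (rieszKernel n α) (midMeasure μ ν)).toReal := by
  rw [← norm_energyVec_sq hαn hμ, ← norm_energyVec_sq hαn hν,
    ← norm_energyVec_sq hαn (memEplus_midMeasure hαn hμ hν), energyVec_midMeasure hαn hμ hν,
    norm_smul, mul_pow, norm_add_sq_real, norm_sub_sq_real]
  norm_num
  ring

end

section

variable {n : ℕ} {α : ℝ} {μ ν : Measure (Rn n)}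

lemma ae_featureMeasure_fst_pos : ∀ᵐ w ∂(featureMeasure n α), 0 < w.1 := by
  refine Measure.quasiMeasurePreserving_fst.ae (p := fun t : ℝ => 0 < t) ?_
  exact (withDensity_absolutelyContinuous _ _).ae_le (ae_restrict_mem measurableSet_Ioi)

lemma gaussFeature_le_one {w : ℝ × Rn n} (hw : 0 < w.1) (x : Rn n) : gaussFeature w x ≤ 1 := by
  rw [gaussFeature, Real.exp_le_one_iff]
  nlinarith [mul_nonneg hw.le (sq_nonneg ‖x - w.2‖)]

lemma continuous_gaussFeature_right (w : ℝ × Rn n) : Continuous (gaussFeature w) :=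
  continuous_gaussFeature.comp (by fun_prop : Continuous fun x : Rn n => (w, x))

lemma integrable_gaussFeature [IsFiniteMeasure μ] {w : ℝ × Rn n} (hw : 0 < w.1) :
    Integrable (gaussFeature w) μ := by
  refine Integrable.of_bound (continuous_gaussFeature_right w).aestronglyMeasurable 1
    (ae_of_all _ fun x => ?_)
  rw [Real.norm_of_nonneg (gaussFeature_pos w x).le]
  exact gaussFeature_le_one hw x

lemma toReal_gaussTransform (w : ℝ × Rn n) :
    (gaussTransform μ w).toReal = ∫ x, gaussFeature w x ∂μ := by
  rw [integral_eq_lintegral_of_nonneg_ae (ae_of_all _ fun x => (gaussFeature_pos w x).le)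
    (continuous_gaussFeature_right w).aestronglyMeasurable]
  rfl

lemma gaussTransform_lt_top_of_isFiniteMeasure [IsFiniteMeasure μ] {w : ℝ × Rn n}
    (hw : 0 < w.1) : gaussTransform μ w < ⊤ :=
  (integrable_gaussFeature hw).lintegral_lt_top

lemma ae_eq_of_tendsto_energyVec (hαn : α < n) {m : ℕ → Measure (Rn n)}
    (hm : ∀ k, memEplus (rieszKernel n α) (m k)) {g : Lp ℝ 2 (featureMeasure n α)}
    (hg : Tendsto (fun k => energyVec n α (m k)) atTop (𝓝 g)) {F : ℝ × Rn n → ℝ}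
    (hF : ∀ᵐ w ∂(featureMeasure n α),
      Tendsto (fun k => (gaussTransform (m k) w).toReal) atTop (𝓝 (F w))) :
    g =ᵐ[featureMeasure n α] F := by
  obtain ⟨s, hs, hlim⟩ := (tendstoInMeasure_of_tendsto_Lp hg).exists_seq_tendsto_ae
  filter_upwards [hlim, hF, ae_all_iff.2 fun k => (hm k).coeFn_energyVec hαn] with w h1 h2 h3
  simp_rw [h3] at h1
  exact tendsto_nhds_unique h1 (h2.comp hs.tendsto_atTop)

/-- A weak limit of probability measures whose representing vectors converge has finite energy
and is represented by the limit vector. -/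
lemma energyVec_of_tendsto (hαn : α < n) {m : ℕ → ProbabilityMeasure (Rn n)}
    {m₀ : ProbabilityMeasure (Rn n)} (hlim : Tendsto m atTop (𝓝 m₀))
    (hm : ∀ k, memEplus (rieszKernel n α) (m k : Measure (Rn n)))
    {g : Lp ℝ 2 (featureMeasure n α)}
    (hg : Tendsto (fun k => energyVec n α (m k : Measure (Rn n))) atTop (𝓝 g)) :
    memEplus (rieszKernel n α) (m₀ : Measure (Rn n)) ∧
      energyVec n α (m₀ : Measure (Rn n)) = g := by
  have hF : ∀ᵐ w ∂(featureMeasure n α),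
      Tendsto (fun k => (gaussTransform (m k : Measure (Rn n)) w).toReal) atTop
        (𝓝 (gaussTransform (m₀ : Measure (Rn n)) w).toReal) := by
    filter_upwards [ae_featureMeasure_fst_pos] with w hw
    simp_rw [toReal_gaussTransform]
    exact (ProbabilityMeasure.tendsto_iff_forall_integral_tendsto.1 hlim)
      (BoundedContinuousFunction.ofNormedAddCommGroup (gaussFeature w)
        (continuous_gaussFeature_right w) 1 fun x => by
          rw [Real.norm_of_nonneg (gaussFeature_pos w x).le]
          exact gaussFeature_le_one hw x)
  have hae := ae_eq_of_tendsto_energyVec hαn hm hg hF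
  have hLp : MemLp (fun w => (gaussTransform (m₀ : Measure (Rn n)) w).toReal) 2
      (featureMeasure n α) := (memLp_congr_ae hae).1 (Lp.memLp g)
  have hmem : memEplus (rieszKernel n α) (m₀ : Measure (Rn n)) := by
    refine ⟨show (m₀ : Measure (Rn n)).Regular from inferInstance,
      energy_lt_top_of_memLp hαn ?_ hLp⟩
    filter_upwards [ae_featureMeasure_fst_pos] with w hw
    exact gaussTransform_lt_top_of_isFiniteMeasure hw
  exact ⟨hmem, Lp.ext ((hmem.coeFn_energyVec hαn).trans hae.symm)⟩

lemma integral_integral_gaussFeature_mul_cexp [IsProbabilityMeasure μ] {t : ℝ} (ht : 0 < t)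
    (ξ : Rn n) :
    ∫ z, (((gaussTransform μ (t, z)).toReal : ℝ) : ℂ) * Complex.exp (Complex.I * inner ℝ ξ z) =
      charFun μ ξ * ∫ z : Rn n, Complex.exp (-(2 * t : ℝ) * ‖z‖ ^ 2 + Complex.I * inner ℝ ξ z) := by
  have hcont : Continuous (fun p : Rn n × Rn n =>
      ((gaussFeature (t, p.2) p.1 : ℝ) : ℂ) * Complex.exp (Complex.I * inner ℝ ξ p.2)) := by
    refine (Complex.continuous_ofReal.comp (continuous_gaussFeature.comp
      (by fun_prop : Continuous fun p : Rn n × Rn n => ((t, p.2), p.1)))).mul (by fun_prop)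
  have hnorm : ∀ p : Rn n × Rn n, ‖((gaussFeature (t, p.2) p.1 : ℝ) : ℂ) *
      Complex.exp (Complex.I * inner ℝ ξ p.2)‖ = Real.exp (-(2 * t) * ‖p.2 - p.1‖ ^ 2) := by
    intro p
    rw [norm_mul, Complex.norm_real, Real.norm_of_nonneg (gaussFeature_pos _ _).le,
      mul_comm Complex.I, Complex.norm_exp_ofReal_mul_I, mul_one, gaussFeature, norm_sub_rev]
  have h_int : Integrable (fun p : Rn n × Rn n =>
      ((gaussFeature (t, p.2) p.1 : ℝ) : ℂ) * Complex.exp (Complex.I * inner ℝ ξ p.2))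
      (μ.prod volume) := by
    rw [integrable_prod_iff hcont.aestronglyMeasurable]
    refine ⟨ae_of_all _ fun x => ?_, ?_⟩
    · refine (integrable_norm_iff (hcont.comp (by fun_prop : Continuous fun z : Rn n =>
        (x, z))).aestronglyMeasurable).1 ?_
      exact (integrable_exp_neg_mul_norm_sq (by positivity) x).congr
        (ae_of_all _ fun z => (hnorm (x, z)).symm)
    · refine (integrable_const (∫ z : Rn n, Real.exp (-(2 * t) * ‖z‖ ^ 2))).congr
        (ae_of_all _ fun x => ?_)
      simp only
      rw [← integral_sub_right_eq_self (fun z : Rn n => Real.exp (-(2 * t) * ‖z‖ ^ 2)) x]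
      exact integral_congr_ae (ae_of_all _ fun z => (hnorm (x, z)).symm)
  calc _ = ∫ z, ∫ x, ((gaussFeature (t, z) x : ℝ) : ℂ) *
        Complex.exp (Complex.I * inner ℝ ξ z) ∂μ := by
        refine integral_congr_ae (ae_of_all _ fun z => ?_)
        simp only
        rw [toReal_gaussTransform, integral_mul_const, integral_complex_ofReal]
    _ = ∫ x, (∫ z, ((gaussFeature (t, z) x : ℝ) : ℂ) *
        Complex.exp (Complex.I * inner ℝ ξ z)) ∂μ := (integral_integral_swap h_int).symm
    _ = ∫ x, Complex.exp (inner ℝ x ξ * Complex.I) *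
          (∫ z : Rn n, Complex.exp (-(2 * t : ℝ) * ‖z‖ ^ 2 + Complex.I * inner ℝ ξ z)) ∂μ := by
        refine integral_congr_ae (ae_of_all _ fun x => ?_)
        simp only
        rw [← integral_const_mul, ← integral_sub_right_eq_self (fun z : Rn n =>
          Complex.exp (inner ℝ x ξ * Complex.I) *
            Complex.exp (-(2 * t : ℝ) * ‖z‖ ^ 2 + Complex.I * inner ℝ ξ z)) x]
        refine integral_congr_ae (ae_of_all _ fun z => ?_)
        simp only [gaussFeature]
        rw [Complex.ofReal_exp, ← Complex.exp_add, ← Complex.exp_add, norm_sub_rev x z,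
          inner_sub_right, real_inner_comm x ξ]
        congr 1
        push_cast
        ring
    _ = _ := by rw [integral_mul_const, charFun_apply]

/-- Probability measures of finite energy are determined by their representing vectors. -/
lemma eq_of_energyVec_eq (hαn : α < n) [IsProbabilityMeasure μ] [IsProbabilityMeasure ν]
    (hμ : memEplus (rieszKernel n α) μ) (hν : memEplus (rieszKernel n α) ν)
    (h : energyVec n α μ = energyVec n α ν) : μ = ν := by
  have hae : ∀ᵐ w ∂(featureMeasure n α),
      (gaussTransform μ w).toReal = (gaussTransform ν w).toReal := by
    filter_upwards [hμ.coeFn_energyVec hαn, hν.coeFn_energyVec hαn] with w h1 h2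
    rw [← h1, ← h2, h]
  have h1 := Measure.ae_ae_of_ae_prod hae
  rw [ae_withDensity_iff (measurable_scaleDensity n α).ennreal_ofReal] at h1
  have : (ae (volume.restrict (Ioi (0 : ℝ)))).NeBot := ae_neBot.2 (by
    simp [Measure.restrict_eq_zero])
  obtain ⟨t, h1, ht⟩ := (h1.and (ae_restrict_mem measurableSet_Ioi)).exists
  have ht : 0 < t := ht
  have hs : 0 < ((n : ℝ) - α) / 2 := by linarith
  have hG := Real.Gamma_pos_of_pos hs
  have h2 := h1 (by
    rw [Ne, ENNReal.ofReal_eq_zero, not_le, scaleDensity]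
    positivity)
  refine Measure.ext_of_charFun (funext fun ξ => ?_)
  have e1 := integral_integral_gaussFeature_mul_cexp (μ := μ) ht ξ
  have e2 := integral_integral_gaussFeature_mul_cexp (μ := ν) ht ξ
  have e3 : ∫ z, (((gaussTransform μ (t, z)).toReal : ℝ) : ℂ) *
        Complex.exp (Complex.I * inner ℝ ξ z) =
      ∫ z, (((gaussTransform ν (t, z)).toReal : ℝ) : ℂ) *
        Complex.exp (Complex.I * inner ℝ ξ z) := by
    refine integral_congr_ae ?_
    filter_upwards [h2] with z hz
    rw [hz]
  rw [e1, e2] at e3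
  refine mul_right_cancel₀ ?_ e3
  have hb : (0 : ℝ) < ((2 * t : ℝ) : ℂ).re := by rw [Complex.ofReal_re]; positivity
  rw [GaussianFourier.integral_cexp_neg_mul_sq_norm_add hb]
  refine mul_ne_zero ?_ (Complex.exp_ne_zero _)
  rw [← Complex.ofReal_div]
  simp [Complex.cpow_eq_zero_iff, ht.ne', Real.pi_ne_zero]

end

lemma lintegral_le_liminf_of_lowerSemicontinuous {X : Type*} [TopologicalSpace X]
    [MeasurableSpace X] [BorelSpace X] {μ : Measure X} {m : ℕ → Measure X} {ψ : X → ℝ≥0∞}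
    (hψ : LowerSemicontinuous ψ)
    (hopen : ∀ G, IsOpen G → μ G ≤ atTop.liminf fun k => m k G) :
    ∫⁻ x, ψ x ∂μ ≤ atTop.liminf fun k => ∫⁻ x, ψ x ∂(m k) := by
  have htrunc : ∀ N : ℕ, ∫⁻ x, min (ψ x) N ∂μ ≤ atTop.liminf fun k => ∫⁻ x, min (ψ x) N ∂(m k) := by
    intro N
    have hlsc : LowerSemicontinuous fun x => min (ψ x) (N : ℝ≥0∞) :=
      hψ.inf lowerSemicontinuous_const
    have hfin : ∀ x, min (ψ x) (N : ℝ≥0∞) ≠ ⊤ := fun x =>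
      ne_top_of_le_ne_top (ENNReal.natCast_ne_top N) (min_le_right _ _)
    have hrepr : ∀ ν : Measure X, ∫⁻ x, min (ψ x) (N : ℝ≥0∞) ∂ν =
        ∫⁻ t in Ioi (0 : ℝ), ν {x | t < (min (ψ x) (N : ℝ≥0∞)).toReal} := fun ν => by
      rw [← lintegral_eq_lintegral_meas_lt ν (ae_of_all _ fun x => ENNReal.toReal_nonneg)
        hlsc.measurable.ennreal_toReal.aemeasurable]
      exact lintegral_congr fun x => (ENNReal.ofReal_toReal (hfin x)).symm
    simp_rw [hrepr]
    refine (setLIntegral_mono' measurableSet_Ioi fun t ht => hopen _ ?_).trans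
      (lintegral_liminf_le fun k => Antitone.measurable fun s t hst =>
        measure_mono fun x hx => lt_of_le_of_lt hst hx)
    convert hlsc.isOpen_preimage (ENNReal.ofReal t) using 1
    ext x
    exact (ENNReal.ofReal_lt_iff_lt_toReal (le_of_lt ht) (hfin x)).symm
  have hsup : ∀ x, ⨆ N : ℕ, min (ψ x) (N : ℝ≥0∞) = ψ x := fun x => by
    rw [← inf_iSup_eq, ENNReal.iSup_natCast, inf_top_eq]
  have : ∫⁻ x, ψ x ∂μ = ⨆ N : ℕ, ∫⁻ x, min (ψ x) (N : ℝ≥0∞) ∂μ := by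
    rw [← lintegral_iSup (fun N => hψ.measurable.min measurable_const)
      fun a b hab x => min_le_min le_rfl (Nat.cast_le.2 hab)]
    simp_rw [hsup]
  rw [this]
  exact iSup_le fun N => (htrunc N).trans
    (liminf_le_liminf (Eventually.of_forall fun k => lintegral_mono fun x => min_le_left _ _))

lemma cauchySeq_of_norm_sub_sq_le {E : Type*} [SeminormedAddCommGroup E] {v : ℕ → E} {δ : ℕ → ℝ}
    (h : ∀ k l, k ≤ l → ‖v k - v l‖ ^ 2 ≤ δ k) (hδ : Tendsto δ atTop (𝓝 0)) : CauchySeq v := by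
  refine cauchySeq_of_le_tendsto_0' (fun k => √(δ k)) (fun k l hkl => ?_) ?_
  · rw [dist_eq_norm]
    exact Real.le_sqrt_of_sq_le (h k l hkl)
  · simpa [Function.comp_def] using (Real.continuous_sqrt.tendsto 0).comp hδ

section

variable {n : ℕ} {α : ℝ} {μ ν : Measure (Rn n)} {A B : Set (Rn n)}

lemma Concentrated.measure_compl_eq_zero (h : Concentrated μ A) : μ Aᶜ = 0 := by
  rw [← inter_univ Aᶜ, ← iUnion_compactCovering (Rn n), inter_iUnion]
  exact measure_iUnion_null fun k => h _ (isCompact_compactCovering _ k)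

lemma concentrated_iff : Concentrated μ A ↔ μ Aᶜ = 0 :=
  ⟨Concentrated.measure_compl_eq_zero, fun h _ _ => measure_mono_null inter_subset_left h⟩

lemma memBreve.isProbabilityMeasure (h : memBreve (rieszKernel n α) A μ) :
    IsProbabilityMeasure μ := ⟨h.2.2⟩

lemma memBreve.mono (hAB : A ⊆ B) (h : memBreve (rieszKernel n α) A μ) :
    memBreve (rieszKernel n α) B μ :=
  ⟨h.1, concentrated_iff.2
    (measure_mono_null (compl_subset_compl.2 hAB) h.2.1.measure_compl_eq_zero), h.2.2⟩

lemma memBreve_midMeasure (hαn : α < n) (hμ : memBreve (rieszKernel n α) A μ)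
    (hν : memBreve (rieszKernel n α) A ν) : memBreve (rieszKernel n α) A (midMeasure μ ν) := by
  refine ⟨memEplus_midMeasure hαn hμ.1 hν.1, concentrated_iff.2 ?_, ?_⟩
  · simp [midMeasure, hμ.2.1.measure_compl_eq_zero, hν.2.1.measure_compl_eq_zero]
  · simp [midMeasure, hμ.2.2, hν.2.2, ENNReal.inv_two_add_inv_two]

lemma wcap_le_energy (h : memBreve (rieszKernel n α) A μ) :
    wcap (rieszKernel n α) A ≤ energy (rieszKernel n α) μ := iInf₂_le μ h

lemma wcap_anti (hAB : A ⊆ B) : wcap (rieszKernel n α) B ≤ wcap (rieszKernel n α) A :=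
  le_iInf₂ fun _ h => wcap_le_energy (h.mono hAB)

lemma tendsto_gaussTransform_of_memBreve_diff {m : ℕ → Measure (Rn n)}
    (hm : ∀ k : ℕ, memBreve (rieszKernel n α) (A \ Metric.closedBall 0 k) (m k))
    {w : ℝ × Rn n} (hw : 0 < w.1) :
    Tendsto (fun k => (gaussTransform (m k) w).toReal) atTop (𝓝 0) := by
  have hlim : Tendsto (fun k : ℕ => Real.exp (-(2 * w.1) * ((k : ℝ) - ‖w.2‖) ^ 2)) atTop (𝓝 0) := by
    refine Real.tendsto_exp_atBot.comp (Tendsto.const_mul_atTop_of_neg (by linarith) ?_)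
    exact (tendsto_pow_atTop two_ne_zero).comp
      (tendsto_atTop_add_const_right _ _ tendsto_natCast_atTop_atTop)
  refine squeeze_zero' (Eventually.of_forall fun k => ENNReal.toReal_nonneg) ?_ hlim
  filter_upwards [eventually_ge_atTop ⌈‖w.2‖⌉₊] with k hk
  have hk : ‖w.2‖ ≤ k := Nat.ceil_le.1 hk
  have := (hm k).isProbabilityMeasure
  refine ENNReal.toReal_le_of_le_ofReal (Real.exp_pos _).le ?_
  have hae : ∀ᵐ x ∂(m k), ENNReal.ofReal (gaussFeature w x) ≤
      ENNReal.ofReal (Real.exp (-(2 * w.1) * ((k : ℝ) - ‖w.2‖) ^ 2)) := by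
    have h0 : ∀ᵐ x ∂(m k), x ∈ A \ Metric.closedBall 0 k := (hm k).2.1.measure_compl_eq_zero
    filter_upwards [h0] with x hx
    have hx : (k : ℝ) < ‖x‖ := by simpa using hx.2
    refine ENNReal.ofReal_le_ofReal (Real.exp_le_exp.2 ?_)
    have h1 : (k : ℝ) - ‖w.2‖ ≤ ‖x - w.2‖ := by linarith [norm_sub_norm_le x w.2]
    have h2 : ((k : ℝ) - ‖w.2‖) ^ 2 ≤ ‖x - w.2‖ ^ 2 :=
      pow_le_pow_left₀ (sub_nonneg.2 hk) h1 2
    nlinarith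
  calc gaussTransform (m k) w ≤ _ := lintegral_mono_ae hae
    _ = _ := by simp

/-- If `A` has finite inner capacity, then the capacities of its tails tend to zero. -/
lemma exists_lt_wcap_diff_closedBall (hαn : α < n) (hcap : innerCap (rieszKernel n α) A ≠ ⊤)
    {M : ℝ≥0∞} (hM : M ≠ ⊤) :
    ∃ k : ℕ, M < wcap (rieszKernel n α) (A \ Metric.closedBall 0 k) := by
  by_contra! hle
  have hA0 : wcap (rieszKernel n α) A ≠ 0 := fun h => hcap (by rw [innerCap, h, ENNReal.inv_zero])
  set b : ℕ → ℝ := fun k => (wcap (rieszKernel n α) (A \ Metric.closedBall 0 k)).toReal with hb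
  have hfin : ∀ k : ℕ, wcap (rieszKernel n α) (A \ Metric.closedBall 0 k) ≠ ⊤ := fun k =>
    ne_top_of_le_ne_top hM (hle k)
  have hanti : ∀ {k l : ℕ}, k ≤ l →
      A \ Metric.closedBall (0 : Rn n) l ⊆ A \ Metric.closedBall 0 k := fun {k l} hkl =>
    sdiff_subset_sdiff_right (Metric.closedBall_subset_closedBall (Nat.cast_le.2 hkl))
  have hmono : Monotone b := fun k l hkl => ENNReal.toReal_mono (hfin l) (wcap_anti (hanti hkl))
  have hbdd : BddAbove (range b) :=
    ⟨M.toReal, by rintro _ ⟨k, rfl⟩; exact ENNReal.toReal_mono hM (hle k)⟩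
  have hblim := tendsto_atTop_ciSup hmono hbdd
  have hex : ∀ k : ℕ, ∃ μ, memBreve (rieszKernel n α) (A \ Metric.closedBall 0 k) μ ∧
      (energy (rieszKernel n α) μ).toReal < b k + 1 / ((k : ℝ) + 1) := by
    intro k
    have hpos : (0 : ℝ) < 1 / ((k : ℝ) + 1) := by positivity
    have : wcap (rieszKernel n α) (A \ Metric.closedBall 0 k) <
        ENNReal.ofReal (b k + 1 / ((k : ℝ) + 1)) := by
      rw [ENNReal.lt_ofReal_iff_toReal_lt (hfin k)]
      exact lt_add_of_pos_right _ hpos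
    obtain ⟨μ, hμ, hlt⟩ := by simpa [wcap, iInf_lt_iff] using this
    exact ⟨μ, hμ, by simpa using (ENNReal.lt_ofReal_iff_toReal_lt hμ.1.2.ne).1 hlt⟩
  choose m hm hE using hex
  have hcauchy : CauchySeq fun k => energyVec n α (m k) := by
    refine cauchySeq_of_norm_sub_sq_le
      (δ := fun k => 2 * ((⨆ i, b i) - b k) + 4 * (1 / ((k : ℝ) + 1))) (fun k l hkl => ?_) ?_
    · have hl := (hm l).mono (hanti hkl)
      have hmid := memBreve_midMeasure hαn (hm k) hl
      have h1 : b k ≤ (energy (rieszKernel n α) (midMeasure (m k) (m l))).toReal :=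
        ENNReal.toReal_mono hmid.1.2.ne (wcap_le_energy hmid)
      have h2 : 1 / ((l : ℝ) + 1) ≤ 1 / ((k : ℝ) + 1) := by gcongr
      rw [norm_energyVec_sub_sq hαn (hm k).1 (hm l).1]
      linarith [hE k, hE l, le_ciSup hbdd l]
    · have := ((tendsto_const_nhds (x := ⨆ i, b i)).sub hblim).const_mul 2 |>.add
        ((tendsto_one_div_add_atTop_nhds_zero_nat (𝕜 := ℝ)).const_mul 4)
      simpa using this
  obtain ⟨g, hg⟩ := cauchySeq_tendsto_of_complete hcauchy
  have hg0 : g = 0 := by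
    have := ae_eq_of_tendsto_energyVec hαn (fun k => (hm k).1) hg (F := fun _ => 0) (by
      filter_upwards [ae_featureMeasure_fst_pos] with w hw
      exact tendsto_gaussTransform_of_memBreve_diff hm hw)
    exact Lp.ext (this.trans (Lp.coeFn_zero _ _ _).symm)
  have hE0 : Tendsto (fun k => (energy (rieszKernel n α) (m k)).toReal) atTop (𝓝 0) := by
    simp_rw [← fun k => norm_energyVec_sq hαn (hm k).1]
    simpa [hg0] using hg.norm.pow 2
  have hAfin : wcap (rieszKernel n α) A ≠ ⊤ :=
    ne_top_of_le_ne_top (hfin 0) (wcap_anti sdiff_subset)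
  have hge : (wcap (rieszKernel n α) A).toReal ≤ 0 := ge_of_tendsto' hE0 fun k =>
    ENNReal.toReal_mono (hm k).1.2.ne (wcap_le_energy ((hm k).mono sdiff_subset))
  exact hge.not_gt (ENNReal.toReal_pos hA0 hAfin)

lemma sq_measure_mul_wcap_le (hαn : α < n) (hμ : memBreve (rieszKernel n α) A μ)
    {B : Set (Rn n)} (hB : MeasurableSet B) :
    μ Bᶜ ^ 2 * wcap (rieszKernel n α) (A \ B) ≤ energy (rieszKernel n α) μ := by
  have := hμ.isProbabilityMeasure
  set c := μ Bᶜ with hc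
  rcases eq_or_ne c 0 with h0 | h0
  · simp [h0]
  have hct : c ≠ ⊤ := measure_ne_top _ _
  have hci : c⁻¹ ≠ ⊤ := ENNReal.inv_ne_top.2 h0
  set ν : Measure (Rn n) := c⁻¹ • μ.restrict Bᶜ with hν
  have hνfin : IsFiniteMeasure ν := ⟨by
    rw [hν, Measure.smul_apply, smul_eq_mul]
    exact ENNReal.mul_lt_top hci.lt_top (measure_lt_top _ _)⟩
  have htr : ∀ w, gaussTransform ν w ≤ c⁻¹ * gaussTransform μ w := fun w => by
    rw [gaussTransform, hν, lintegral_smul_measure, smul_eq_mul]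
    exact mul_le_mul_right (setLIntegral_le_lintegral _ _) _
  have hen : energy (rieszKernel n α) ν ≤ c⁻¹ ^ 2 * energy (rieszKernel n α) μ := by
    rw [energy_eq_lintegral hαn, energy_eq_lintegral hαn,
      ← lintegral_const_mul _ (measurable_gaussTransform.pow_const 2)]
    refine lintegral_mono fun w => ?_
    rw [← mul_pow]
    exact pow_le_pow_left₀ zero_le (htr w) 2
  have hmem : memBreve (rieszKernel n α) (A \ B) ν := by
    refine ⟨⟨show ν.Regular from inferInstance,
      hen.trans_lt (ENNReal.mul_lt_top (ENNReal.pow_lt_top hci.lt_top) hμ.1.2)⟩,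
      concentrated_iff.2 ?_, ?_⟩
    · have h1 : μ.restrict Bᶜ (A \ B)ᶜ = 0 := by
        rw [Measure.restrict_apply' hB.compl]
        refine measure_mono_null ?_ hμ.2.1.measure_compl_eq_zero
        rintro x ⟨hx, hxB⟩ hxA
        exact hx ⟨hxA, hxB⟩
      rw [hν, Measure.smul_apply, h1, smul_zero]
    · rw [hν, Measure.smul_apply, Measure.restrict_apply_univ, smul_eq_mul,
        ENNReal.inv_mul_cancel h0 hct]
  calc c ^ 2 * wcap (rieszKernel n α) (A \ B)
      ≤ c ^ 2 * (c⁻¹ ^ 2 * energy (rieszKernel n α) μ) := by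
        gcongr
        exact (wcap_le_energy hmem).trans hen
    _ = energy (rieszKernel n α) μ := by
        rw [← mul_assoc, ← mul_pow, ENNReal.mul_inv_cancel h0 hct, one_pow, one_mul]

/-- Unit measures of bounded energy on a set of finite inner capacity are tight. -/
lemma isTightMeasureSet_of_energy_le (hαn : α < n) (hcap : innerCap (rieszKernel n α) A ≠ ⊤)
    {C : ℝ≥0∞} (hC : C ≠ ⊤) {S : Set (Measure (Rn n))}
    (hS : ∀ μ ∈ S, memBreve (rieszKernel n α) A μ ∧ energy (rieszKernel n α) μ ≤ C) :
    IsTightMeasureSet S := by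
  refine isTightMeasureSet_iff_exists_isCompact_measure_compl_le.2 fun ε hε => ?_
  rcases eq_or_ne ε ⊤ with rfl | hεt
  · exact ⟨∅, isCompact_empty, fun _ _ => le_top⟩
  have hε2 : ε ^ 2 ≠ 0 := pow_ne_zero 2 hε.ne'
  have hε2t : ε ^ 2 ≠ ⊤ := ENNReal.pow_ne_top hεt
  obtain ⟨k, hk⟩ := exists_lt_wcap_diff_closedBall hαn hcap (ENNReal.div_ne_top hC hε2)
  refine ⟨Metric.closedBall 0 k, isCompact_closedBall _ _, fun μ hμ => ?_⟩
  by_contra! hlt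
  have h1 := (sq_measure_mul_wcap_le hαn (hS μ hμ).1
    (B := Metric.closedBall 0 (k : ℝ)) measurableSet_closedBall).trans (hS μ hμ).2
  have h2 : C < ε ^ 2 * wcap (rieszKernel n α) (A \ Metric.closedBall 0 k) := by
    rwa [mul_comm, ← ENNReal.div_lt_iff (Or.inl hε2) (Or.inl hε2t)]
  exact (h2.trans_le (by gcongr)).not_ge h1

end

lemma add_sub_eq_coe_toReal {p : EReal} {u v : ℝ≥0∞} (hp0 : 0 ≤ p) (hp : p ≠ ⊤) (hu : u ≠ ⊤)
    (hv : v ≠ ⊤) :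
    p + (u : EReal) - (v : EReal) = ((p.toReal + u.toReal - v.toReal : ℝ) : EReal) := by
  have hb : p ≠ ⊥ := fun h => by simp [h] at hp0
  lift p to ℝ using ⟨hp, hb⟩
  lift u to NNReal using hu
  lift v to NNReal using hv
  rfl

section

variable {n : ℕ} {α : ℝ} {μ ν θ : Measure (Rn n)} {A : Set (Rn n)}

lemma measurable_rieszKernel : Measurable fun p : Rn n × Rn n => rieszKernel n α p.1 p.2 :=
  (measurable_dist.ennreal_ofReal).pow_const _

lemma measurable_potential [SFinite θ] : Measurable (potential (rieszKernel n α) θ) :=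
  measurable_rieszKernel.lintegral_prod_right'

lemma lintegral_potential [SFinite θ] :
    ∫⁻ x, potential (rieszKernel n α) θ x ∂μ = mutualEnergy (rieszKernel n α) μ θ :=
  (lintegral_prod _ measurable_rieszKernel.aemeasurable).symm

lemma potential_lt_top_ae (hαn : α < n) (hμ : memEplus (rieszKernel n α) μ)
    (hθ : memEplus (rieszKernel n α) θ) :
    ∀ᵐ x ∂μ, potential (rieszKernel n α) θ x < ⊤ := by
  have := hθ.sigmaFinite
  refine ae_lt_top measurable_potential ?_
  rw [lintegral_potential]
  exact (mutualEnergy_lt_top hαn hμ hθ).ne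

lemma integrable_potential (hαn : α < n) (hμ : memEplus (rieszKernel n α) μ)
    (hθ : memEplus (rieszKernel n α) θ) :
    Integrable (fun x => (potential (rieszKernel n α) θ x).toReal) μ := by
  have := hθ.sigmaFinite
  refine integrable_toReal_of_lintegral_ne_top measurable_potential.aemeasurable ?_
  rw [lintegral_potential]
  exact (mutualEnergy_lt_top hαn hμ hθ).ne

lemma integral_potential (hαn : α < n) (hμ : memEplus (rieszKernel n α) μ)
    (hθ : memEplus (rieszKernel n α) θ) :
    ∫ x, (potential (rieszKernel n α) θ x).toReal ∂μ =
      inner ℝ (energyVec n α μ) (energyVec n α θ) := by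
  have := hθ.sigmaFinite
  rw [integral_toReal measurable_potential.aemeasurable (potential_lt_top_ae hαn hμ hθ),
    lintegral_potential, inner_energyVec hαn hμ hθ]

variable {f ψ : Rn n → EReal} {θp θm : Measure (Rn n)}

section

variable (hαn : α < n) (hψ : LowerSemicontinuous ψ) (hψ0 : ∀ x, 0 ≤ ψ x)
  (hp : memEplus (rieszKernel n α) θp) (hm : memEplus (rieszKernel n α) θm)
  (hf : ∀ x, f x = ψ x + (potential (rieszKernel n α) θp x : EReal) -
    (potential (rieszKernel n α) θm x : EReal))

include hαn hψ hψ0 hp hm hf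

lemma fieldIntegrable_iff (hμ : memEplus (rieszKernel n α) μ) :
    FieldIntegrable f μ ↔ ∫⁻ x, (ψ x).toENNReal ∂μ < ⊤ := by
  have hip := integrable_potential hαn hμ hp
  have him := integrable_potential hαn hμ hm
  constructor
  · rintro ⟨h_int, hfin⟩
    have hψt : ∀ᵐ x ∂μ, ψ x ≠ ⊤ := by
      filter_upwards [hfin, potential_lt_top_ae hαn hμ hm] with x h1 h2 h3
      refine h1.1 ?_
      rw [hf x, h3, EReal.top_add_of_ne_bot (by simp), sub_eq_add_neg,
        EReal.top_add_of_ne_bot]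
      rw [Ne, EReal.neg_eq_bot_iff]
      simpa using h2.ne
    have hψint : Integrable (fun x => (ψ x).toReal) μ := by
      refine ((h_int.sub hip).add him).congr ?_
      filter_upwards [hψt, potential_lt_top_ae hαn hμ hm, potential_lt_top_ae hαn hμ hp]
        with x h1 h2 h3
      simp only [Pi.add_apply, Pi.sub_apply]
      rw [hf x, add_sub_eq_coe_toReal (hψ0 x) h1 h3.ne h2.ne, EReal.toReal_coe]
      ring
    refine lt_of_le_of_lt (lintegral_mono_ae ?_) hψint.lintegral_lt_top
    filter_upwards [hψt] with x h1
    rw [EReal.toENNReal_of_ne_top h1]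
  · intro hlt
    have hψm : Measurable fun x => (ψ x).toENNReal := hψ.measurable.ereal_toENNReal
    have hψt : ∀ᵐ x ∂μ, ψ x ≠ ⊤ := by
      filter_upwards [ae_lt_top hψm hlt.ne] with x h1 h2
      simp [h2] at h1
    have hψint : Integrable (fun x => (ψ x).toReal) μ := by
      refine (integrable_toReal_of_lintegral_ne_top hψm.aemeasurable hlt.ne).congr
        (ae_of_all _ fun x => EReal.toReal_toENNReal (hψ0 x))
    have hae : ∀ᵐ x ∂μ, f x = (((ψ x).toReal + (potential (rieszKernel n α) θp x).toReal -
        (potential (rieszKernel n α) θm x).toReal : ℝ) : EReal) := by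
      filter_upwards [hψt, potential_lt_top_ae hαn hμ hm, potential_lt_top_ae hαn hμ hp]
        with x h1 h2 h3
      rw [hf x, add_sub_eq_coe_toReal (hψ0 x) h1 h3.ne h2.ne]
    refine ⟨((hψint.add hip).sub him).congr ?_, ?_⟩
    · filter_upwards [hae] with x hx
      rw [hx, EReal.toReal_coe]
      rfl
    · filter_upwards [hae] with x hx
      rw [hx]
      exact ⟨EReal.coe_ne_top _, EReal.coe_ne_bot _⟩

lemma gaussI_eq (hμ : memEplus (rieszKernel n α) μ) (hfμ : FieldIntegrable f μ) :
    gaussI (rieszKernel n α) f μ = ‖energyVec n α μ‖ ^ 2 +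
      2 * ((∫⁻ x, (ψ x).toENNReal ∂μ).toReal + inner ℝ (energyVec n α μ) (energyVec n α θp) -
        inner ℝ (energyVec n α μ) (energyVec n α θm)) := by
  have hip := integrable_potential hαn hμ hp
  have him := integrable_potential hαn hμ hm
  have hlt := (fieldIntegrable_iff hαn hψ hψ0 hp hm hf hμ).1 hfμ
  have hψm : Measurable fun x => (ψ x).toENNReal := hψ.measurable.ereal_toENNReal
  have hψt := ae_lt_top hψm hlt.ne
  have hψint := integrable_toReal_of_lintegral_ne_top hψm.aemeasurable hlt.ne
  have hsum : Integrable (fun x => (ψ x).toENNReal.toReal +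
      (potential (rieszKernel n α) θp x).toReal) μ := hψint.add hip
  rw [gaussI, norm_energyVec_sq hαn hμ, ← integral_potential hαn hμ hp,
    ← integral_potential hαn hμ hm, ← integral_toReal hψm.aemeasurable hψt,
    ← integral_add hψint hip, ← integral_sub hsum him, fieldIntegral]
  congr 2
  refine integral_congr_ae ?_
  filter_upwards [hψt, potential_lt_top_ae hαn hμ hm, potential_lt_top_ae hαn hμ hp]
    with x h1 h2 h3
  have h1 : ψ x ≠ ⊤ := fun h => by simp [h] at h1
  rw [hf x, add_sub_eq_coe_toReal (hψ0 x) h1 h3.ne h2.ne, EReal.toReal_coe,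
    EReal.toReal_toENNReal (hψ0 x)]

lemma neg_norm_sq_le_gaussI (hμ : memEplus (rieszKernel n α) μ) (hfμ : FieldIntegrable f μ) :
    -‖energyVec n α θm‖ ^ 2 ≤ gaussI (rieszKernel n α) f μ := by
  have h1 : 0 ≤ inner ℝ (energyVec n α μ) (energyVec n α θp) := by
    rw [inner_energyVec hαn hμ hp]
    exact ENNReal.toReal_nonneg
  have h2 := norm_sub_sq_real (energyVec n α μ) (energyVec n α θm)
  rw [gaussI_eq hαn hψ hψ0 hp hm hf hμ hfμ]
  have h3 := ENNReal.toReal_nonneg (a := ∫⁻ x, (ψ x).toENNReal ∂μ)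
  nlinarith [sq_nonneg ‖energyVec n α μ - energyVec n α θm‖]

lemma admissible_midMeasure (hμ : Admissible (rieszKernel n α) A f μ)
    (hν : Admissible (rieszKernel n α) A f ν) :
    Admissible (rieszKernel n α) A f (midMeasure μ ν) := by
  have hmid := memBreve_midMeasure hαn hμ.1 hν.1
  have h1 := (fieldIntegrable_iff hαn hψ hψ0 hp hm hf hμ.1.1).1 hμ.2
  have h2 := (fieldIntegrable_iff hαn hψ hψ0 hp hm hf hν.1.1).1 hν.2
  refine ⟨hmid, (fieldIntegrable_iff hαn hψ hψ0 hp hm hf hmid.1).2 ?_⟩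
  rw [midMeasure, lintegral_add_measure, lintegral_smul_measure, lintegral_smul_measure]
  exact ENNReal.add_lt_top.2 ⟨ENNReal.mul_lt_top (by simp) h1, ENNReal.mul_lt_top (by simp) h2⟩

lemma norm_energyVec_sub_sq_eq_gaussI (hμ : Admissible (rieszKernel n α) A f μ)
    (hν : Admissible (rieszKernel n α) A f ν) :
    ‖energyVec n α μ - energyVec n α ν‖ ^ 2 = 2 * gaussI (rieszKernel n α) f μ +
      2 * gaussI (rieszKernel n α) f ν - 4 * gaussI (rieszKernel n α) f (midMeasure μ ν) := by
  have hmid := admissible_midMeasure hαn hψ hψ0 hp hm hf hμ hν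
  have h1 := (fieldIntegrable_iff hαn hψ hψ0 hp hm hf hμ.1.1).1 hμ.2
  have h2 := (fieldIntegrable_iff hαn hψ hψ0 hp hm hf hν.1.1).1 hν.2
  have h3 : (∫⁻ x, (ψ x).toENNReal ∂(midMeasure μ ν)).toReal =
      2⁻¹ * (∫⁻ x, (ψ x).toENNReal ∂μ).toReal + 2⁻¹ * (∫⁻ x, (ψ x).toENNReal ∂ν).toReal := by
    rw [midMeasure, lintegral_add_measure, lintegral_smul_measure, lintegral_smul_measure,
      smul_eq_mul, smul_eq_mul, ENNReal.toReal_add (ENNReal.mul_lt_top (by simp) h1).ne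
        (ENNReal.mul_lt_top (by simp) h2).ne]
    simp
  rw [norm_energyVec_sub_sq hαn hμ.1.1 hν.1.1, ← norm_energyVec_sq hαn hμ.1.1,
    ← norm_energyVec_sq hαn hν.1.1, ← norm_energyVec_sq hαn hmid.1.1,
    gaussI_eq hαn hψ hψ0 hp hm hf hμ.1.1 hμ.2, gaussI_eq hαn hψ hψ0 hp hm hf hν.1.1 hν.2,
    gaussI_eq hαn hψ hψ0 hp hm hf hmid.1.1 hmid.2, h3, energyVec_midMeasure hαn hμ.1.1 hν.1.1,
    real_inner_smul_left, real_inner_smul_left, inner_add_left, inner_add_left]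
  ring

end

end

lemma not_compactSpace_Rn {n : ℕ} (hn : 2 ≤ n) : ¬ CompactSpace (Rn n) := by
  have : Nonempty (Fin n) := ⟨⟨0, by omega⟩⟩
  exact not_compactSpace_iff.2 (NormedSpace.noncompactSpace ℝ (Rn n))

section

variable {n : ℕ} {α : ℝ} {A : Set (Rn n)} {f : Rn n → EReal} {r : ℝ}

lemma le_gaussI (hr : wf (rieszKernel n α) A f = r) {μ : Measure (Rn n)}
    (hμ : Admissible (rieszKernel n α) A f μ) : r ≤ gaussI (rieszKernel n α) f μ := by
  rw [← EReal.coe_le_coe_iff, ← hr]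
  exact iInf₂_le μ hμ

lemma exists_gaussI_lt (hr : wf (rieszKernel n α) A f = r) {s : ℝ} (hs : r < s) :
    ∃ μ, Admissible (rieszKernel n α) A f μ ∧ gaussI (rieszKernel n α) f μ < s := by
  have : wf (rieszKernel n α) A f < s := by rwa [hr, EReal.coe_lt_coe_iff]
  simpa [wf, iInf_lt_iff] using this

variable {ψ : Rn n → EReal} {θp θm : Measure (Rn n)}
  (hαn : α < n) (hψ : LowerSemicontinuous ψ) (hψ0 : ∀ x, 0 ≤ ψ x)
  (hp : memEplus (rieszKernel n α) θp) (hm : memEplus (rieszKernel n α) θm)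
  (hf : ∀ x, f x = ψ x + (potential (rieszKernel n α) θp x : EReal) -
    (potential (rieszKernel n α) θm x : EReal))

include hαn hψ hψ0 hp hm hf

lemma exists_wf_eq_coe (hw : wf (rieszKernel n α) A f < ⊤) :
    ∃ r : ℝ, wf (rieszKernel n α) A f = r := by
  have hbot : wf (rieszKernel n α) A f ≠ ⊥ := by
    have : ((-‖energyVec n α θm‖ ^ 2 : ℝ) : EReal) ≤ wf (rieszKernel n α) A f :=
      le_iInf₂ fun μ hμ => EReal.coe_le_coe_iff.2
        (neg_norm_sq_le_gaussI hαn hψ hψ0 hp hm hf hμ.1.1 hμ.2)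
    exact ((EReal.bot_lt_coe _).trans_le this).ne'
  exact ⟨_, (EReal.coe_toReal hw.ne hbot).symm⟩

lemma norm_energyVec_sub_sq_le (hr : wf (rieszKernel n α) A f = r) {μ ν : Measure (Rn n)}
    (hμ : Admissible (rieszKernel n α) A f μ) (hν : Admissible (rieszKernel n α) A f ν) :
    ‖energyVec n α μ - energyVec n α ν‖ ^ 2 ≤
      2 * (gaussI (rieszKernel n α) f μ - r) + 2 * (gaussI (rieszKernel n α) f ν - r) := by
  rw [norm_energyVec_sub_sq_eq_gaussI hαn hψ hψ0 hp hm hf hμ hν]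
  linarith [le_gaussI hr (admissible_midMeasure hαn hψ hψ0 hp hm hf hμ hν)]

lemma IsSolution.unique (hr : wf (rieszKernel n α) A f = r) {μ ν : Measure (Rn n)}
    (hμ : IsSolution (rieszKernel n α) A f μ) (hν : IsSolution (rieszKernel n α) A f ν) :
    μ = ν := by
  have h1 : gaussI (rieszKernel n α) f μ = r := EReal.coe_eq_coe_iff.1 (hμ.2.trans hr)
  have h2 : gaussI (rieszKernel n α) f ν = r := EReal.coe_eq_coe_iff.1 (hν.2.trans hr)
  have h3 := norm_energyVec_sub_sq_le hαn hψ hψ0 hp hm hf hr hμ.1 hν.1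
  rw [h1, h2, sub_self, mul_zero, add_zero] at h3
  have := hμ.1.1.isProbabilityMeasure
  have := hν.1.1.isProbabilityMeasure
  exact eq_of_energyVec_eq hαn hμ.1.1.1 hν.1.1.1
    (sub_eq_zero.1 (norm_eq_zero.1 (pow_eq_zero_iff two_ne_zero |>.1 (le_antisymm h3
      (sq_nonneg _)))))

/-- Lower semicontinuity of the Gauss functional along a weakly convergent sequence of admissible
measures whose representing vectors converge. -/
lemma gaussI_le_of_tendsto {m : ℕ → ProbabilityMeasure (Rn n)} {m₀ : ProbabilityMeasure (Rn n)}
    (hlim : Tendsto m atTop (𝓝 m₀))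
    (hadm : ∀ k, Admissible (rieszKernel n α) A f (m k : Measure (Rn n)))
    (hg : Tendsto (fun k => energyVec n α (m k : Measure (Rn n))) atTop
      (𝓝 (energyVec n α (m₀ : Measure (Rn n)))))
    (hm₀ : memEplus (rieszKernel n α) (m₀ : Measure (Rn n)))
    (hI : Tendsto (fun k => gaussI (rieszKernel n α) f (m k : Measure (Rn n))) atTop (𝓝 r)) :
    FieldIntegrable f (m₀ : Measure (Rn n)) ∧
      gaussI (rieszKernel n α) f (m₀ : Measure (Rn n)) ≤ r := by
  have hfin := fun k => (fieldIntegrable_iff hαn hψ hψ0 hp hm hf (hadm k).1.1).1 (hadm k).2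
  have heq := fun k => gaussI_eq hαn hψ hψ0 hp hm hf (hadm k).1.1 (hadm k).2
  set v₀ := energyVec n α (m₀ : Measure (Rn n)) with hv₀
  set c : ℝ := (r - ‖v₀‖ ^ 2) / 2 - inner ℝ v₀ (energyVec n α θp) +
    inner ℝ v₀ (energyVec n α θm) with hc
  have hclim : Tendsto (fun k => (∫⁻ x, (ψ x).toENNReal ∂(m k : Measure (Rn n))).toReal) atTop
      (𝓝 c) := by
    have h1 := (((hI.sub (hg.norm.pow 2)).div_const 2).sub
      (hg.inner (tendsto_const_nhds (x := energyVec n α θp)))).add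
      (hg.inner (tendsto_const_nhds (x := energyVec n α θm)))
    refine h1.congr fun k => ?_
    rw [heq k]
    ring
  have hc0 : 0 ≤ c := ge_of_tendsto' hclim fun k => ENNReal.toReal_nonneg
  have hlsc : LowerSemicontinuous fun x => (ψ x).toENNReal :=
    EReal.continuous_toENNReal.comp_lowerSemicontinuous hψ fun _ _ h =>
      EReal.toENNReal_le_toENNReal h
  have hle : ∫⁻ x, (ψ x).toENNReal ∂(m₀ : Measure (Rn n)) ≤ ENNReal.ofReal c := by
    refine (lintegral_le_liminf_of_lowerSemicontinuous hlsc fun G hG =>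
      ProbabilityMeasure.le_liminf_measure_open_of_tendsto hlim hG).trans_eq ?_
    refine Tendsto.liminf_eq ((ENNReal.tendsto_ofReal hclim).congr fun k => ?_)
    exact ENNReal.ofReal_toReal (hfin k).ne
  have hadm₀ := (fieldIntegrable_iff hαn hψ hψ0 hp hm hf hm₀).2 (hle.trans_lt ENNReal.ofReal_lt_top)
  refine ⟨hadm₀, ?_⟩
  have h2 := ENNReal.toReal_le_of_le_ofReal hc0 hle
  rw [gaussI_eq hαn hψ hψ0 hp hm hf hm₀ hadm₀]
  linarith

lemma exists_isSolution (hr : wf (rieszKernel n α) A f = r)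
    (hclosed : StrongClosedEplusOn (rieszKernel n α) A)
    (hcap : innerCap (rieszKernel n α) A ≠ ⊤) :
    ∃ l, IsSolution (rieszKernel n α) A f l := by
  have hex : ∀ k : ℕ, ∃ μ : ProbabilityMeasure (Rn n),
      Admissible (rieszKernel n α) A f (μ : Measure (Rn n)) ∧
      gaussI (rieszKernel n α) f (μ : Measure (Rn n)) < r + 1 / ((k : ℝ) + 1) := fun k => by
    obtain ⟨μ, hμ, hlt⟩ := exists_gaussI_lt hr
      (lt_add_of_pos_right r (by positivity : (0 : ℝ) < 1 / ((k : ℝ) + 1)))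
    exact ⟨⟨μ, hμ.1.isProbabilityMeasure⟩, hμ, hlt⟩
  choose m hadm hlt using hex
  have hI : Tendsto (fun k => gaussI (rieszKernel n α) f (m k : Measure (Rn n))) atTop (𝓝 r) := by
    refine tendsto_of_tendsto_of_tendsto_of_le_of_le tendsto_const_nhds
      (by simpa using (tendsto_one_div_add_atTop_nhds_zero_nat (𝕜 := ℝ)).const_add r)
      (fun k => le_gaussI hr (hadm k)) fun k => (hlt k).le
  have hcauchy : CauchySeq fun k => energyVec n α (m k : Measure (Rn n)) := by
    refine cauchySeq_of_norm_sub_sq_le (δ := fun k => 4 * (1 / ((k : ℝ) + 1))) (fun k l hkl => ?_)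
      (by simpa using (tendsto_one_div_add_atTop_nhds_zero_nat (𝕜 := ℝ)).const_mul 4)
    have h1 : 1 / ((l : ℝ) + 1) ≤ 1 / ((k : ℝ) + 1) := by gcongr
    linarith [norm_energyVec_sub_sq_le hαn hψ hψ0 hp hm hf hr (hadm k) (hadm l), hlt k, hlt l]
  obtain ⟨g, hg⟩ := cauchySeq_tendsto_of_complete hcauchy
  obtain ⟨C, hC⟩ := hg.norm.bddAbove_range
  have hE : ∀ k, energy (rieszKernel n α) (m k : Measure (Rn n)) ≤ ENNReal.ofReal (C ^ 2) :=
    fun k => by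
      rw [← ENNReal.ofReal_toReal (hadm k).1.1.2.ne, ← norm_energyVec_sq hαn (hadm k).1.1]
      exact ENNReal.ofReal_le_ofReal (pow_le_pow_left₀ (norm_nonneg _) (hC ⟨k, rfl⟩) 2)
  have htight : IsTightMeasureSet {((μ : ProbabilityMeasure (Rn n)) : Measure (Rn n)) |
      μ ∈ range m} := by
    refine isTightMeasureSet_of_energy_le hαn hcap (C := ENNReal.ofReal (C ^ 2))
      ENNReal.ofReal_ne_top ?_
    rintro _ ⟨_, ⟨k, rfl⟩, rfl⟩
    exact ⟨(hadm k).1, hE k⟩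
  obtain ⟨m₀, -, φ, hφ, hlim⟩ := (isCompact_closure_of_isTightMeasureSet htight).tendsto_subseq
    fun k => subset_closure (mem_range_self k)
  have hgφ := hg.comp hφ.tendsto_atTop
  obtain ⟨hm₀, rfl⟩ := energyVec_of_tendsto hαn hlim (fun k => (hadm (φ k)).1.1) hgφ
  have hconc : Concentrated (m₀ : Measure (Rn n)) A := by
    refine hclosed (fun k => (m k : Measure (Rn n))) _
      (fun k => ⟨(hadm k).1.1, (hadm k).1.2.1⟩) hm₀ ?_
    have := tendsto_iff_norm_sub_tendsto_zero.1 hg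
    exact this.congr fun k => (strongDist_eq_norm hαn (hadm k).1.1 hm₀).symm
  obtain ⟨h_int, hle⟩ := gaussI_le_of_tendsto hαn hψ hψ0 hp hm hf hlim (fun k => hadm (φ k)) hgφ
    hm₀ (hI.comp hφ.tendsto_atTop)
  have hadm₀ : Admissible (rieszKernel n α) A f (m₀ : Measure (Rn n)) :=
    ⟨⟨hm₀, hconc, measure_univ⟩, h_int⟩
  exact ⟨m₀, hadm₀, by rw [hr, le_antisymm hle (le_gaussI hr hadm₀)]⟩

end

theorem stmt11 (n : ℕ) (hn : 2 ≤ n) (α : ℝ) (hα0 : 0 < α) (hαn : α < n)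
    (f : Rn n → EReal) (A : Set (Rn n))
    (hf : IsExternalField (rieszKernel n α) f)
    (hclosed : StrongClosedEplusOn (rieszKernel n α) A)
    (hw : wf (rieszKernel n α) A f < ⊤)
    (hcap : innerCap (rieszKernel n α) A ≠ ⊤) :
    ∃! l : Measure (Rn n), IsSolution (rieszKernel n α) A f l := by
  obtain ⟨ψ, θp, θm, hψ, -, hψ0, hp, hm, hfield⟩ := hf
  replace hψ0 := hψ0 (not_compactSpace_Rn hn)
  obtain ⟨r, hr⟩ := exists_wf_eq_coe hαn hψ hψ0 hp hm hfield hw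
  obtain ⟨l, hl⟩ := exists_isSolution hαn hψ hψ0 hp hm hfield hr hclosed hcap
  exact ⟨l, hl, fun _ h => h.unique hαn hψ hψ0 hp hm hfield hr hl⟩

end GaussVar
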